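/- Let f be harmonic on Π and continuous on the closure of Π, and let M > 0, α > 0 and z₁ ∈ Π. Suppose: ∫_a^b max(f(x), 0) dx ≤ M; f(z) ≤ M·(Im z)^{−α} for all z ∈ Π; and f(z₁) ≥ −M. Then for each δ with 0 < δ < (b − a)/2 there exists a constant C > 0, depending only on a, b, c, α, δ, M and z₁ (not on f), such that ∫_{a+δ}^{b−δ} min(f(x), 0) dx ≥ −C. -/

import Mathlib

/-- The open rectangle `Π = {z : a < Re z < b, 0 < Im z < c}`. -/
def rectangle (a b c : ℝ) : Set ℂ :=
  {z : ℂ | a < z.re ∧ z.re < b ∧ 0 < z.im ∧ z.im < c}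

/-- `f : ℂ → ℝ` is harmonic on `s`: twice continuously differentiable with
`Δf = f_xx + f_yy = 0` on `s`. -/
def IsHarmonicOn (f : ℂ → ℝ) (s : Set ℂ) : Prop :=
  ContDiffOn ℝ 2 f s ∧
  ∀ z ∈ s, fderiv ℝ (fun w => fderiv ℝ f w 1) z 1 +
    fderiv ℝ (fun w => fderiv ℝ f w Complex.I) z Complex.I = 0

section

open Complex ComplexConjugate InnerProductSpace Laplacian

theorem isOpen_rectangle (a b c : ℝ) : IsOpen (rectangle a b c) := by
  unfold rectangle
  exact (isOpen_lt continuous_const continuous_re).inter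
    ((isOpen_lt continuous_re continuous_const).inter
    ((isOpen_lt continuous_const continuous_im).inter (isOpen_lt continuous_im continuous_const)))

theorem fderiv_fderiv_apply {f : ℂ → ℝ} {z : ℂ} (hf : ContDiffAt ℝ 2 f z) (v : ℂ) :
    fderiv ℝ (fun w => fderiv ℝ f w v) z v = iteratedFDeriv ℝ 2 f z ![v, v] := by
  have hd : DifferentiableAt ℝ (fderiv ℝ f) z :=
    (hf.fderiv_right (m := 1) (by norm_num)).differentiableAt one_ne_zero
  rw [iteratedFDeriv_two_apply, fderiv_clm_apply hd (by fun_prop)]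
  simp

theorem IsHarmonicOn.harmonicOnNhd {f : ℂ → ℝ} {s : Set ℂ} (hs : IsOpen s)
    (hf : IsHarmonicOn f s) : HarmonicOnNhd f s := by
  intro z hz
  refine ⟨hf.1.contDiffAt (hs.mem_nhds hz), ?_⟩
  filter_upwards [hs.mem_nhds hz] with w hw
  have hc := hf.1.contDiffAt (hs.mem_nhds hw)
  rw [laplacian_eq_iteratedFDeriv_complexPlane]
  simp only [Pi.zero_apply]
  rw [← fderiv_fderiv_apply hc, ← fderiv_fderiv_apply hc]
  exact hf.2 w hw

theorem harmonicAt_comp_analyticAt {f : ℂ → ℝ} {g : ℂ → ℂ} {w : ℂ} (hg : AnalyticAt ℂ g w)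
    (hf : HarmonicAt f (g w)) : HarmonicAt (f ∘ g) w := by
  obtain ⟨ε, hε, hb⟩ := Metric.isOpen_iff.1 (isOpen_setOfPred_harmonicAt f) (g w) hf
  obtain ⟨F, hF, hFf⟩ := HarmonicOnNhd.exists_analyticOnNhd_ball_re_eq (f := f)
    (fun y hy => hb hy)
  have h1 : AnalyticAt ℂ (F ∘ g) w := (hF (g w) (Metric.mem_ball_self hε)).comp hg
  have h2 : HarmonicAt (fun z => ((F ∘ g) z).re) w := h1.harmonicAt_re
  refine (harmonicAt_congr_nhds ?_).1 h2
  filter_upwards [hg.continuousAt.preimage_mem_nhds (Metric.ball_mem_nhds _ hε)] with y hy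
  exact hFf hy

theorem poissonKernel_le_four {p q z : ℂ} {R : ℝ} (hR : 0 < R) (hq : ‖q - p‖ ≤ R / 2)
    (hz : ‖z - p‖ = R) : 0 ≤ poissonKernel p q z ∧ poissonKernel p q z ≤ 4 := by
  have h1 : R / 2 ≤ ‖(z - p) - (q - p)‖ := by
    have := norm_sub_norm_le (z - p) (q - p)
    linarith
  rw [poissonKernel_def, hz]
  have h0 := norm_nonneg (q - p)
  refine ⟨div_nonneg (by nlinarith) (by positivity), ?_⟩
  have h2 : 0 < ‖(z - p) - (q - p)‖ := by linarith
  rw [div_le_iff₀ (by positivity)]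
  nlinarith

theorem harnack_four {u : ℂ → ℝ} {p q : ℂ} {R : ℝ} (hR : 0 < R)
    (hu : HarmonicOnNhd u (Metric.closedBall p R)) (hu0 : ∀ z ∈ Metric.closedBall p R, 0 ≤ u z)
    (hq : ‖q - p‖ ≤ R / 2) : u q ≤ 4 * u p := by
  have hqb : q ∈ Metric.ball p R := by
    rw [mem_ball_iff_norm]; linarith
  rw [← hu.circleAverage_poissonKernel_smul hqb]
  have h2 := InnerProductSpace.HarmonicOnNhd.circleAverage_eq (f := u) (c := p) (R := R) (by rwa [abs_of_pos hR])
  rw [← h2, ← smul_eq_mul, ← Real.circleAverage_fun_smul]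
  have hcont : ContinuousOn u (Metric.sphere p R) :=
    hu.continuousOn.mono Metric.sphere_subset_closedBall
  have hk : ContinuousOn (poissonKernel p q) (Metric.sphere p R) := by
    have : poissonKernel p q = fun z => (‖z - p‖ ^ 2 - ‖q - p‖ ^ 2) / ‖(z - p) - (q - p)‖ ^ 2 :=
      funext fun z => poissonKernel_def p q z
    rw [this]
    refine ContinuousOn.div (by fun_prop) (by fun_prop) fun z hz => ?_
    rw [mem_sphere_iff_norm] at hz
    have := norm_sub_norm_le (z - p) (q - p)
    have : 0 < ‖(z - p) - (q - p)‖ := by linarith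
    positivity
  apply Real.circleAverage_mono
  · exact ContinuousOn.circleIntegrable hR.le (hk.smul hcont)
  · exact ContinuousOn.circleIntegrable hR.le (hcont.const_smul (4 : ℝ))
  · intro z hz
    rw [abs_of_pos hR] at hz
    have := poissonKernel_le_four hR hq (mem_sphere_iff_norm.1 hz)
    exact mul_le_mul_of_nonneg_right this.2 (hu0 z (Metric.sphere_subset_closedBall hz))

theorem convex_rectangle (a b c : ℝ) : Convex ℝ (rectangle a b c) := by
  rw [convex_iff_forall_pos]
  rintro z ⟨h1, h2, h3, h4⟩ w ⟨k1, k2, k3, k4⟩ s t hs ht hst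
  obtain rfl : s = 1 - t := by linarith
  refine ⟨?_, ?_, ?_, ?_⟩ <;> simp <;> nlinarith

theorem exists_forall_le_of_segment {U : Set ℂ} (hU : IsOpen U) {K : ℂ → ℝ}
    (hK : ContinuousOn K U) {z₁ z₂ : ℂ}
    (hseg : segment ℝ z₁ z₂ ⊆ U) (m : ℝ) :
    ∃ C : ℝ, ∀ f : ℂ → ℝ, HarmonicOnNhd f U → (∀ z ∈ U, f z ≤ K z) → -m ≤ f z₁ → -C ≤ f z₂ := by
  have hcomp : IsCompact (segment ℝ z₁ z₂) := by
    rw [segment_eq_image_lineMap]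
    exact isCompact_Icc.image AffineMap.lineMap_continuous
  obtain ⟨R, hR, hRU⟩ := hcomp.exists_cthickening_subset_open hU hseg
  have hcomp' : IsCompact (Metric.cthickening R (segment ℝ z₁ z₂)) := hcomp.cthickening
  obtain ⟨k, hk⟩ := hcomp'.bddAbove_image (hK.mono hRU)
  obtain ⟨N, hN⟩ := exists_nat_gt (‖z₂ - z₁‖ / (R / 2))
  have hN0 : (0 : ℝ) < N := lt_of_le_of_lt (by positivity) hN
  rw [div_lt_iff₀ (by positivity)] at hN
  refine ⟨4 ^ N * (k + m) - k, fun f hf hfK hf1 => ?_⟩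
  let p : ℕ → ℂ := fun j => AffineMap.lineMap z₁ z₂ ((j : ℝ) / N)
  have hball : ∀ j ≤ N, Metric.closedBall (p j) R ⊆ Metric.cthickening R (segment ℝ z₁ z₂) := by
    intro j hj
    apply Metric.closedBall_subset_cthickening
    rw [segment_eq_image_lineMap]
    refine ⟨_, ⟨by positivity, ?_⟩, rfl⟩
    rw [div_le_one hN0]
    exact_mod_cast hj
  have hstep : ∀ j ≤ N, k - f (p j) ≤ 4 ^ j * (k + m) := by
    intro j
    induction j with
    | zero =>
      intro _
      have : p 0 = z₁ := by simp [p]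
      rw [this]; linarith
    | succ j ih =>
      intro hj
      have hj' : j ≤ N := by omega
      have h1 : ‖p (j + 1) - p j‖ ≤ R / 2 := by
        have : p (j + 1) - p j = ((1 / N : ℝ) : ℂ) * (z₂ - z₁) := by
          simp only [p, AffineMap.lineMap_apply, vsub_eq_sub, vadd_eq_add, Complex.real_smul]
          push_cast
          ring
        rw [this, norm_mul, Complex.norm_real, Real.norm_of_nonneg (by positivity),
          one_div, inv_mul_le_iff₀ hN0]
        linarith
      have h2 := harnack_four (u := fun z => k - f z) hR
        ((harmonicOnNhd_const k).sub (hf.mono ((hball j hj').trans hRU)))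
        (fun z hz => by
          have e1 := hfK z (hRU (hball j hj' hz))
          have e2 := hk (Set.mem_image_of_mem K (hball j hj' hz))
          linarith) h1
      have := ih hj'
      rw [pow_succ]
      linarith
  have hlast : p N = z₂ := by simp [p, div_self hN0.ne']
  have := hstep N le_rfl
  rw [hlast] at this
  linarith

/-- A conformal map of the unit disc onto the lens in the upper half-plane bounded by the segment
`[a, b]` and a circular arc meeting it at the angle `πβ`. -/
noncomputable def lensMap (a b β : ℝ) (w : ℂ) : ℂ :=
  a + (b - a) * (exp (Real.pi * β / 2 * I) * (1 + w) ^ (β : ℂ) /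
    ((1 - w) ^ (β : ℂ) + exp (Real.pi * β / 2 * I) * (1 + w) ^ (β : ℂ)))

theorem one_add_re_pos {w : ℂ} (hw : ‖w‖ ≤ 1) (h : w ≠ -1) : 0 < (1 + w).re := by
  have h1 : w.re ^ 2 + w.im ^ 2 ≤ 1 := by
    have := Complex.sq_norm w
    rw [Complex.normSq_apply] at this
    nlinarith [norm_nonneg w]
  by_contra! h2
  simp only [add_re, one_re] at h2
  apply h
  apply Complex.ext
  · simp; nlinarith [sq_nonneg w.im]
  · simp; nlinarith [sq_nonneg w.im]

theorem one_sub_re_pos {w : ℂ} (hw : ‖w‖ ≤ 1) (h : w ≠ 1) : 0 < (1 - w).re := by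
  have := one_add_re_pos (w := -w) (by simpa using hw) (by simpa using h)
  simpa [sub_eq_add_neg] using this

theorem arg_mul_conj {p q : ℂ} (hp : 0 < p.re) (hq : 0 < q.re) :
    arg (q * conj p) = arg q - arg p := by
  have h1 := Complex.abs_arg_lt_pi_div_two_iff.2 (Or.inl hp)
  have h2 := Complex.abs_arg_lt_pi_div_two_iff.2 (Or.inl hq)
  rw [abs_lt] at h1 h2
  have hp0 : p ≠ 0 := by rintro rfl; simp at hp
  have hq0 : q ≠ 0 := by rintro rfl; simp at hq
  have h3 : arg (conj p) = - arg p := by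
    rw [Complex.arg_conj, if_neg]; linarith
  rw [Complex.arg_mul hq0 (by simpa using hp0), h3, sub_eq_add_neg]
  rw [h3]; constructor <;> linarith

theorem lensMap_eq (a b : ℝ) {β : ℝ} {w : ℂ} (hw : ‖w‖ ≤ 1) (h : w ≠ 1) (h' : w ≠ -1) :
    lensMap a b β w = a + (b - a) * (
      (((‖1 + w‖ / ‖1 - w‖) ^ β : ℝ) *
        exp ((β * (Real.pi / 2 + arg ((1 + w) * conj (1 - w))) : ℝ) * I)) /
      (1 + ((‖1 + w‖ / ‖1 - w‖) ^ β : ℝ) *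
        exp ((β * (Real.pi / 2 + arg ((1 + w) * conj (1 - w))) : ℝ) * I))) := by
  have hp := one_sub_re_pos hw h
  have hq := one_add_re_pos hw h'
  have hp0 : 1 - w ≠ 0 := sub_ne_zero.2 h.symm
  have hq0 : 1 + w ≠ 0 := by intro h0; rw [h0] at hq; simp at hq
  have hA : (1 - w) ^ (β : ℂ) ≠ 0 := by simp [Complex.cpow_eq_zero_iff, hp0]
  have hpn := norm_pos_iff.2 hp0
  have hqn := norm_pos_iff.2 hq0
  have key : exp (Real.pi * β / 2 * I) * (1 + w) ^ (β : ℂ) =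
      (1 - w) ^ (β : ℂ) * (((‖1 + w‖ / ‖1 - w‖) ^ β : ℝ) *
        exp ((β * (Real.pi / 2 + arg ((1 + w) * conj (1 - w))) : ℝ) * I)) := by
    rw [arg_mul_conj hp hq, Complex.cpow_def_of_ne_zero hp0, Complex.cpow_def_of_ne_zero hq0,
      Real.rpow_def_of_pos (by positivity), Real.log_div hqn.ne' hpn.ne', Complex.ofReal_exp,
      ← Complex.exp_add, ← Complex.exp_add, ← Complex.exp_add]
    congr 1
    simp only [Complex.log]
    push_cast
    ring
  rw [lensMap, key]
  congr 2
  rw [show (1 - w) ^ (β : ℂ) + (1 - w) ^ (β : ℂ) * (((‖1 + w‖ / ‖1 - w‖) ^ β : ℝ) *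
        exp ((β * (Real.pi / 2 + arg ((1 + w) * conj (1 - w))) : ℝ) * I)) =
     (1 - w) ^ (β : ℂ) * (1 + ((‖1 + w‖ / ‖1 - w‖) ^ β : ℝ) *
        exp ((β * (Real.pi / 2 + arg ((1 + w) * conj (1 - w))) : ℝ) * I)) by ring]
  rw [mul_div_mul_left _ _ hA]

theorem re_div_one_add (ρ η : ℝ) : (ρ * exp (η * I) / (1 + ρ * exp (η * I))).re =
    (ρ * Real.cos η + ρ ^ 2) / (1 + 2 * ρ * Real.cos η + ρ ^ 2) := by
  rw [Complex.exp_mul_I, ← ofReal_cos, ← ofReal_sin, Complex.div_re, ← add_div]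
  have h := Real.sin_sq_add_cos_sq η
  generalize Real.cos η = x at *
  generalize Real.sin η = y at *
  congr 1
  · simp; linear_combination ρ ^ 2 * h
  · simp [normSq_apply]; linear_combination ρ ^ 2 * h

theorem im_div_one_add (ρ η : ℝ) : (ρ * exp (η * I) / (1 + ρ * exp (η * I))).im =
    ρ * Real.sin η / (1 + 2 * ρ * Real.cos η + ρ ^ 2) := by
  rw [Complex.exp_mul_I, ← ofReal_cos, ← ofReal_sin, Complex.div_im, ← sub_div]
  have h := Real.sin_sq_add_cos_sq η
  generalize Real.cos η = x at *
  generalize Real.sin η = y at *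
  congr 1
  · simp; ring
  · simp [normSq_apply]; linear_combination ρ ^ 2 * h


theorem add_mul_div_mem_rectangle {a b c ρ η : ℝ} (hab : a < b) (hρ : 0 < ρ) (h0 : 0 < η)
    (h1 : η < Real.pi / 2) (h2 : (b - a) * η < c) :
    a + (b - a) * (ρ * exp (η * I) / (1 + ρ * exp (η * I))) ∈ rectangle a b c := by
  have hc : 0 < Real.cos η := Real.cos_pos_of_mem_Ioo ⟨by linarith, h1⟩
  have hs : 0 < Real.sin η := Real.sin_pos_of_pos_of_lt_pi h0 (by linarith)
  have hsη : Real.sin η < η := Real.sin_lt h0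
  have hd : 0 < 1 + 2 * ρ * Real.cos η + ρ ^ 2 := by positivity
  have hL : 0 < b - a := by linarith
  set z := (ρ * exp (η * I) / (1 + ρ * exp (η * I)) : ℂ) with hz
  have hre := re_div_one_add ρ η
  have him := im_div_one_add ρ η
  rw [← hz] at hre him
  have hr0 : 0 < z.re := by rw [hre]; positivity
  have hr1 : z.re < 1 := by
    rw [hre, div_lt_one hd]; nlinarith
  have hi0 : 0 < z.im := by rw [him]; positivity
  have hi1 : z.im < η := by
    rw [him, div_lt_iff₀ hd]
    nlinarith [sq_nonneg (1 - ρ), mul_pos hρ hc, mul_pos h0 (mul_pos hρ hc)]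
  have e1 : (a + (b - a) * z : ℂ).re = a + (b - a) * z.re := by simp
  have e2 : (a + (b - a) * z : ℂ).im = (b - a) * z.im := by simp
  refine ⟨?_, ?_, ?_, ?_⟩
  · rw [e1]; nlinarith
  · rw [e1]; nlinarith
  · rw [e2]; positivity
  · rw [e2]; nlinarith

theorem one_add_mul_conj_re (w : ℂ) : ((1 + w) * conj (1 - w)).re = 1 - ‖w‖ ^ 2 := by
  rw [Complex.sq_norm, normSq_apply]; simp; ring

theorem one_add_mul_conj_im (w : ℂ) : ((1 + w) * conj (1 - w)).im = 2 * w.im := by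
  simp; ring

theorem lensMap_mem_rectangle {a b c β : ℝ} {w : ℂ} (hab : a < b) (hβ : 0 < β) (hβ' : β < 1 / 2)
    (hβc : (b - a) * (Real.pi * β) < c) (hw : ‖w‖ ≤ 1) (h : ‖w‖ < 1 ∨ 0 < w.im) :
    lensMap a b β w ∈ rectangle a b c := by
  have h1 : w ≠ 1 := by rintro rfl; simp at h
  have h2 : w ≠ -1 := by rintro rfl; simp at h
  have hp := norm_pos_iff.2 (sub_ne_zero.2 h1.symm)
  have hq : 0 < ‖1 + w‖ := norm_pos_iff.2 fun h0 => h2 (by linear_combination h0)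
  have hre := one_add_mul_conj_re w
  have him := one_add_mul_conj_im w
  have hpi := Real.pi_pos
  have harg : |arg ((1 + w) * conj (1 - w))| ≤ Real.pi / 2 :=
    Complex.abs_arg_le_pi_div_two_iff.2 (by rw [hre]; nlinarith [norm_nonneg w])
  have harg' : -(Real.pi / 2) < arg ((1 + w) * conj (1 - w)) := by
    rcases h with h | h
    · have := Complex.abs_arg_lt_pi_div_two_iff.2
        (Or.inl (by rw [hre]; nlinarith [norm_nonneg w]) :
          0 < ((1 + w) * conj (1 - w)).re ∨ (1 + w) * conj (1 - w) = 0)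
      exact (abs_lt.1 this).1
    · have := Complex.arg_nonneg_iff.2 (show 0 ≤ ((1 + w) * conj (1 - w)).im by rw [him]; linarith)
      linarith
  rw [abs_le] at harg
  rw [lensMap_eq a b hw h1 h2]
  have hle : β * (Real.pi / 2 + arg ((1 + w) * conj (1 - w))) ≤ Real.pi * β := by nlinarith
  apply add_mul_div_mem_rectangle hab (by positivity)
  · apply mul_pos hβ; linarith
  · nlinarith
  · exact lt_of_le_of_lt (mul_le_mul_of_nonneg_left hle (by linarith)) hβc

theorem cpow_re_nonneg {β : ℝ} {q : ℂ} (hβ : 0 < β) (hβ' : β < 1 / 2) (hq : 0 < q.re) :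
    0 < (q ^ (β : ℂ)).re ∧ 0 < (exp (Real.pi * β / 2 * I) * q ^ (β : ℂ)).re := by
  have hq0 : q ≠ 0 := by rintro rfl; simp at hq
  have h2 := abs_lt.1 (Complex.abs_arg_lt_pi_div_two_iff.2 (Or.inl hq))
  have hpi := Real.pi_pos
  rw [Complex.cpow_def_of_ne_zero hq0, ← Complex.exp_add]
  constructor <;> rw [Complex.exp_re] <;> apply mul_pos (Real.exp_pos _) <;>
    apply Real.cos_pos_of_mem_Ioo <;> simp [Complex.log_im] <;> constructor <;> nlinarith

theorem lensMap_denom_ne_zero {β : ℝ} {w : ℂ} (hβ : 0 < β) (hβ' : β < 1 / 2) (hw : ‖w‖ ≤ 1) :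
    (1 - w) ^ (β : ℂ) + exp (Real.pi * β / 2 * I) * (1 + w) ^ (β : ℂ) ≠ 0 := by
  have hβ0 : (β : ℂ) ≠ 0 := by exact_mod_cast hβ.ne'
  by_cases h1 : w = 1
  · subst h1
    simp [Complex.zero_cpow hβ0, Complex.cpow_eq_zero_iff]
  by_cases h2 : w = -1
  · subst h2
    simp [Complex.zero_cpow hβ0, Complex.cpow_eq_zero_iff]
  have hp := (cpow_re_nonneg hβ hβ' (one_sub_re_pos hw h1)).1
  have hq := (cpow_re_nonneg hβ hβ' (one_add_re_pos hw h2)).2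
  intro h0
  have := congrArg Complex.re h0
  rw [add_re, zero_re] at this
  linarith

theorem continuousOn_lensMap (a b : ℝ) {β : ℝ} (hβ : 0 < β) (hβ' : β < 1 / 2) :
    ContinuousOn (lensMap a b β) (Metric.closedBall 0 1) := by
  have key : ∀ q : ℂ, (0 < q.re ∨ q = 0) → ContinuousAt (fun z : ℂ => z ^ (β : ℂ)) q := by
    rintro q (hq | rfl)
    · exact continuousAt_cpow_const (Or.inl hq)
    · exact Complex.continuousAt_cpow_const_of_re_pos (by simp) (by simpa using hβ)
  intro w hw
  rw [mem_closedBall_zero_iff] at hw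
  have hA : ContinuousAt (fun w : ℂ => (1 - w) ^ (β : ℂ)) w := by
    refine ContinuousAt.comp (f := fun w : ℂ => 1 - w) (g := fun z : ℂ => z ^ (β : ℂ))
      (key _ ?_) (by fun_prop)
    by_cases h : w = 1
    · simp [h]
    · exact Or.inl (one_sub_re_pos hw h)
  have hB : ContinuousAt (fun w : ℂ => (1 + w) ^ (β : ℂ)) w := by
    refine ContinuousAt.comp (f := fun w : ℂ => 1 + w) (g := fun z : ℂ => z ^ (β : ℂ))
      (key _ ?_) (by fun_prop)
    by_cases h : w = -1
    · simp [h]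
    · exact Or.inl (one_add_re_pos hw h)
  apply ContinuousAt.continuousWithinAt
  unfold lensMap
  exact continuousAt_const.add (continuousAt_const.mul ((continuousAt_const.mul hB).div
    (hA.add (continuousAt_const.mul hB)) (lensMap_denom_ne_zero hβ hβ' hw)))

theorem differentiableOn_lensMap (a b : ℝ) {β : ℝ} (hβ : 0 < β) (hβ' : β < 1 / 2) :
    DifferentiableOn ℂ (lensMap a b β) (Metric.ball 0 1) := by
  intro w hw
  rw [mem_ball_zero_iff] at hw
  have hA : DifferentiableAt ℂ (fun w : ℂ => (1 - w) ^ (β : ℂ)) w :=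
    DifferentiableAt.cpow_const (by fun_prop) (Or.inl (one_sub_re_pos hw.le (by rintro rfl; simp at hw)))
  have hB : DifferentiableAt ℂ (fun w : ℂ => (1 + w) ^ (β : ℂ)) w :=
    DifferentiableAt.cpow_const (by fun_prop) (Or.inl (one_add_re_pos hw.le (by rintro rfl; simp at hw)))
  apply DifferentiableAt.differentiableWithinAt
  unfold lensMap
  exact ((((hB.const_mul _).div
    (hA.add (hB.const_mul _)) (lensMap_denom_ne_zero hβ hβ' hw.le))).const_mul _).const_add _

theorem norm_one_add_circleMap (θ : ℝ) : ‖1 + circleMap 0 1 θ‖ = 2 * |Real.cos (θ / 2)| := by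
  rw [← abs_of_nonneg (norm_nonneg (1 + circleMap 0 1 θ)), ← abs_two (α := ℝ), ← abs_mul,
    ← sq_eq_sq_iff_abs_eq_abs, Complex.sq_norm, normSq_apply]
  have h := Real.cos_sq (θ / 2)
  rw [show 2 * (θ / 2) = θ by ring] at h
  have h2 := Real.sin_sq_add_cos_sq θ
  simp [circleMap, exp_ofReal_mul_I_re, exp_ofReal_mul_I_im]
  nlinarith

theorem norm_one_sub_circleMap (θ : ℝ) : ‖1 - circleMap 0 1 θ‖ = 2 * |Real.sin (θ / 2)| := by
  rw [← abs_of_nonneg (norm_nonneg (1 - circleMap 0 1 θ)), ← abs_two (α := ℝ), ← abs_mul,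
    ← sq_eq_sq_iff_abs_eq_abs, Complex.sq_norm, normSq_apply]
  have h := Real.cos_sq (θ / 2)
  rw [show 2 * (θ / 2) = θ by ring] at h
  have h3 := Real.sin_sq_add_cos_sq (θ / 2)
  have h2 := Real.sin_sq_add_cos_sq θ
  simp [circleMap, exp_ofReal_mul_I_re, exp_ofReal_mul_I_im]
  nlinarith

theorem circleMap_im (θ : ℝ) : (circleMap 0 1 θ).im = Real.sin θ := by
  simp [circleMap, exp_ofReal_mul_I_im]

theorem norm_circleMap_one (θ : ℝ) : ‖circleMap 0 1 θ‖ = 1 := by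
  simp

/-- The angle `θ ∈ (π, 2π)` with `lensMap a b n⁻¹ (exp (iθ)) = x`. -/
noncomputable def lensAngle (a b : ℝ) (n : ℕ) (x : ℝ) : ℝ :=
  Real.pi + 2 * Real.arctan (((x - a) / (b - x)) ^ n)

theorem lensAngle_mem {a b x : ℝ} (n : ℕ) (hx : x ∈ Set.Ioo a b) :
    lensAngle a b n x ∈ Set.Ioo Real.pi (2 * Real.pi) := by
  have h1 : 0 < x - a := by linarith [hx.1]
  have h2 : 0 < b - x := by linarith [hx.2]
  have h3 : 0 < Real.arctan (((x - a) / (b - x)) ^ n) := Real.arctan_pos.2 (by positivity)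
  have h4 := Real.arctan_lt_pi_div_two (((x - a) / (b - x)) ^ n)
  unfold lensAngle
  constructor <;> linarith

theorem lensMap_lensAngle {a b x : ℝ} {n : ℕ} (hn : n ≠ 0) (hx : x ∈ Set.Ioo a b) :
    lensMap a b (n : ℝ)⁻¹ (circleMap 0 1 (lensAngle a b n x)) = x := by
  have h1 : 0 < x - a := by linarith [hx.1]
  have h2 : 0 < b - x := by linarith [hx.2]
  have hmem := lensAngle_mem n hx
  have hsin : Real.sin (lensAngle a b n x) < 0 := by
    rw [← Real.sin_sub_two_pi]
    exact Real.sin_neg_of_neg_of_neg_pi_lt (by linarith [hmem.2]) (by linarith [hmem.1])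
  set w := circleMap 0 1 (lensAngle a b n x) with hw
  have him : w.im < 0 := by rw [hw, circleMap_im]; exact hsin
  have hw1 : ‖w‖ = 1 := norm_circleMap_one _
  have harg : arg ((1 + w) * conj (1 - w)) = -(Real.pi / 2) := by
    rw [arg_eq_neg_pi_div_two_iff, one_add_mul_conj_re, one_add_mul_conj_im, hw1]
    constructor
    · norm_num
    · linarith
  rw [lensMap_eq a b hw1.le (by intro h; simp [h] at him) (by intro h; simp [h] at him), harg]
  set r := ((x - a) / (b - x)) ^ n with hr
  have hr0 : 0 < r := by positivity
  have hratio : ‖1 + w‖ / ‖1 - w‖ = r := by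
    rw [hw, norm_one_add_circleMap, norm_one_sub_circleMap, lensAngle, ← hr,
      show (Real.pi + 2 * Real.arctan r) / 2 = Real.arctan r + Real.pi / 2 by ring,
      Real.cos_add_pi_div_two, Real.sin_add_pi_div_two, abs_neg, mul_div_mul_left _ _ two_ne_zero,
      ← abs_div, ← Real.tan_eq_sin_div_cos, Real.tan_arctan, abs_of_pos hr0]
  rw [hratio, hr, Real.pow_rpow_inv_natCast (by positivity) hn]
  simp only [add_neg_cancel, mul_zero, ofReal_zero, zero_mul, exp_zero, mul_one]
  have h3 : (b : ℂ) - x ≠ 0 := by exact_mod_cast h2.ne'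
  have h4 : (b : ℂ) - a ≠ 0 := by exact_mod_cast (show b - a ≠ 0 by linarith)
  push_cast
  have h5 : (1 : ℂ) + (x - a) / (b - x) = (b - a) / (b - x) := by field_simp; ring
  rw [h5]
  field_simp
  ring

/-- The derivative of `lensAngle`: up to the factor `2π`, the density of the harmonic measure of the
lens on `[a, b]` seen from `lensMap a b n⁻¹ 0`. -/
noncomputable def lensDensity (a b : ℝ) (n : ℕ) (x : ℝ) : ℝ :=
  2 * n * (b - a) * (x - a) ^ (n - 1) * (b - x) ^ (n - 1) / ((b - x) ^ (2 * n) + (x - a) ^ (2 * n))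

theorem hasDerivAt_lensAngle {a b x : ℝ} {n : ℕ} (hn : n ≠ 0) (hx : x ∈ Set.Ioo a b) :
    HasDerivAt (lensAngle a b n) (lensDensity a b n x) x := by
  have h1 : 0 < x - a := by linarith [hx.1]
  have h2 : 0 < b - x := by linarith [hx.2]
  have hd : HasDerivAt (fun x => (x - a) / (b - x)) ((b - a) / (b - x) ^ 2) x := by
    refine (((hasDerivAt_id' x).sub_const a).div ((hasDerivAt_id' x).const_sub b)
      h2.ne').congr_deriv ?_
    ring
  have := (((hd.pow n).arctan).const_mul 2).const_add Real.pi
  refine this.congr_deriv ?_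
  obtain ⟨m, rfl⟩ := Nat.exists_eq_succ_of_ne_zero hn
  simp only [lensDensity, Nat.succ_eq_add_one, Nat.add_sub_cancel, Pi.pow_apply, div_pow]
  generalize x - a = X at *
  generalize b - x = Y at *
  generalize b - a = L at *
  field_simp
  ring

theorem continuousOn_lensDensity {a b : ℝ} (hab : a < b) (n : ℕ) :
    ContinuousOn (lensDensity a b n) (Set.Icc a b) := by
  unfold lensDensity
  refine ContinuousOn.div (by fun_prop) (by fun_prop) fun x hx => ?_
  have e1 : 0 ≤ (b - x) ^ (2 * n) := (even_two_mul n).pow_nonneg _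
  have e2 : 0 ≤ (x - a) ^ (2 * n) := (even_two_mul n).pow_nonneg _
  rcases hx.1.eq_or_lt with rfl | h
  · have : 0 < (b - a) ^ (2 * n) := pow_pos (by linarith) _
    linarith
  · have : 0 < (x - a) ^ (2 * n) := pow_pos (by linarith) _
    linarith

theorem lensDensity_nonneg {a b x : ℝ} (n : ℕ) (hx : x ∈ Set.Icc a b) :
    0 ≤ lensDensity a b n x := by
  have h1 : 0 ≤ x - a := by linarith [hx.1]
  have h2 : 0 ≤ b - x := by linarith [hx.2]
  have h3 : 0 ≤ b - a := by linarith
  unfold lensDensity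
  positivity

theorem lensDensity_pos {a b x : ℝ} {n : ℕ} (hn : n ≠ 0) (hx : x ∈ Set.Ioo a b) :
    0 < lensDensity a b n x := by
  have h1 : 0 < x - a := by linarith [hx.1]
  have h2 : 0 < b - x := by linarith [hx.2]
  have h3 : 0 < b - a := by linarith
  have : 0 < n := by omega
  unfold lensDensity
  positivity

theorem lensAngle_image {a b : ℝ} {n : ℕ} (hab : a < b) (hn : n ≠ 0) :
    lensAngle a b n '' Set.Ioo a b = Set.Ioo Real.pi (2 * Real.pi) := by
  apply Set.Subset.antisymm
  · rintro _ ⟨x, hx, rfl⟩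
    exact lensAngle_mem n hx
  · intro t ht
    have hr : 0 < Real.tan ((t - Real.pi) / 2) :=
      Real.tan_pos_of_pos_of_lt_pi_div_two (by linarith [ht.1]) (by linarith [ht.2])
    set ρ := Real.tan ((t - Real.pi) / 2) ^ (n : ℝ)⁻¹ with hρ
    have hρ0 : 0 < ρ := Real.rpow_pos_of_pos hr _
    have e1 : (a + b * ρ) / (1 + ρ) - a = (b - a) * ρ / (1 + ρ) := by field_simp; ring
    have e2 : b - (a + b * ρ) / (1 + ρ) = (b - a) / (1 + ρ) := by field_simp; ring
    have hL : 0 < b - a := by linarith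
    refine ⟨(a + b * ρ) / (1 + ρ), ⟨?_, ?_⟩, ?_⟩
    · have : 0 < (b - a) * ρ / (1 + ρ) := by positivity
      linarith
    · have : 0 < (b - a) / (1 + ρ) := by positivity
      linarith
    · rw [lensAngle, e1, e2, show (b - a) * ρ / (1 + ρ) / ((b - a) / (1 + ρ)) = ρ by field_simp,
        hρ, Real.rpow_inv_natCast_pow hr.le hn, Real.arctan_tan (by linarith [ht.1, Real.pi_pos])
        (by linarith [ht.2])]
      ring

theorem integral_comp_lensMap_circleMap {a b : ℝ} {n : ℕ} (hab : a < b) (hn : n ≠ 0) (f : ℂ → ℝ) :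
    ∫ θ in Real.pi..(2 * Real.pi), f (lensMap a b (n : ℝ)⁻¹ (circleMap 0 1 θ)) =
      ∫ x in a..b, lensDensity a b n x * f x := by
  have hpi := Real.pi_pos
  rw [intervalIntegral.integral_of_le (by linarith), intervalIntegral.integral_of_le hab.le,
    MeasureTheory.integral_Ioc_eq_integral_Ioo, MeasureTheory.integral_Ioc_eq_integral_Ioo,
    ← lensAngle_image hab hn,
    MeasureTheory.integral_image_eq_integral_abs_deriv_smul measurableSet_Ioo
      (fun x hx => (hasDerivAt_lensAngle hn hx).hasDerivWithinAt)]
  · refine MeasureTheory.setIntegral_congr_fun measurableSet_Ioo fun x hx => ?_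
    simp only [smul_eq_mul]
    rw [lensMap_lensAngle hn hx, abs_of_pos (lensDensity_pos hn hx)]
  · intro x hx y hy hxy
    have h1 := lensMap_lensAngle hn hx
    rw [hxy, lensMap_lensAngle hn hy] at h1
    exact_mod_cast h1.symm

theorem le_im_lensMap_circleMap {a b β θ : ℝ} (hab : a < b) (hβ : 0 < β) (hβ' : β < 1 / 2)
    (hθ : θ ∈ Set.Ioo 0 Real.pi) :
    (b - a) * Real.sin (β * Real.pi) / 8 * Real.sin θ ^ β ≤
      (lensMap a b β (circleMap 0 1 θ)).im := by
  have hpi := Real.pi_pos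
  have hsin : 0 < Real.sin θ := Real.sin_pos_of_mem_Ioo hθ
  have hs : 0 < Real.sin (θ / 2) :=
    Real.sin_pos_of_pos_of_lt_pi (by linarith [hθ.1]) (by linarith [hθ.2])
  have hc : 0 < Real.cos (θ / 2) :=
    Real.cos_pos_of_mem_Ioo ⟨by linarith [hθ.1], by linarith [hθ.2]⟩
  have hη : 0 < Real.sin (β * Real.pi) := Real.sin_pos_of_pos_of_lt_pi (by positivity) (by nlinarith)
  have hη' : 0 < Real.cos (β * Real.pi) := Real.cos_pos_of_mem_Ioo ⟨by nlinarith, by nlinarith⟩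
  set w := circleMap 0 1 θ with hw
  have him : 0 < w.im := by rw [hw, circleMap_im]; exact hsin
  have hw1 : ‖w‖ = 1 := norm_circleMap_one _
  have harg : arg ((1 + w) * conj (1 - w)) = Real.pi / 2 := by
    rw [arg_eq_pi_div_two_iff, one_add_mul_conj_re, one_add_mul_conj_im, hw1]
    constructor
    · norm_num
    · linarith
  rw [lensMap_eq a b hw1.le (by intro h; simp [h] at him) (by intro h; simp [h] at him), harg,
    add_halves]
  have hratio : ‖1 + w‖ / ‖1 - w‖ = Real.cos (θ / 2) / Real.sin (θ / 2) := by
    rw [hw, norm_one_add_circleMap, norm_one_sub_circleMap, abs_of_pos hs, abs_of_pos hc,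
      mul_div_mul_left _ _ two_ne_zero]
  rw [hratio, Real.div_rpow hc.le hs.le]
  set P := Real.cos (θ / 2) ^ β with hP
  set Q := Real.sin (θ / 2) ^ β with hQ
  have hP0 : 0 < P := Real.rpow_pos_of_pos hc _
  have hQ0 : 0 < Q := Real.rpow_pos_of_pos hs _
  have hP1 : P ≤ 1 := Real.rpow_le_one hc.le (Real.cos_le_one _) hβ.le
  have hQ1 : Q ≤ 1 := Real.rpow_le_one hs.le (Real.sin_le_one _) hβ.le
  have hsinβ : Real.sin θ ^ β ≤ 2 * (P * Q) := by
    have h2 : (2 : ℝ) ^ β ≤ 2 := by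
      calc (2 : ℝ) ^ β ≤ 2 ^ (1 : ℝ) := Real.rpow_le_rpow_of_exponent_le one_le_two (by linarith)
        _ = 2 := Real.rpow_one 2
    rw [show θ = 2 * (θ / 2) by ring, Real.sin_two_mul, Real.mul_rpow (by positivity) hc.le,
      Real.mul_rpow two_pos.le hs.le, ← hP, ← hQ]
    nlinarith [mul_pos hP0 hQ0]
  have hL : 0 < b - a := by linarith
  have e2 : ∀ z : ℂ, (a + (b - a) * z : ℂ).im = (b - a) * z.im := by simp
  rw [e2, im_div_one_add, mul_div_assoc, mul_assoc]
  refine mul_le_mul_of_nonneg_left ?_ hL.le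
  rw [show P / Q * Real.sin (β * Real.pi) / (1 + 2 * (P / Q) * Real.cos (β * Real.pi) + (P / Q) ^ 2)
    = P * Q * Real.sin (β * Real.pi) / (Q ^ 2 + 2 * P * Q * Real.cos (β * Real.pi) + P ^ 2) by
      field_simp]
  rw [le_div_iff₀ (by positivity)]
  have hden : Q ^ 2 + 2 * P * Q * Real.cos (β * Real.pi) + P ^ 2 ≤ 4 := by
    have : P * Q * Real.cos (β * Real.pi) ≤ 1 :=
      mul_le_one₀ (mul_le_one₀ hP1 hQ0.le hQ1) hη'.le (Real.cos_le_one _)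
    nlinarith
  calc Real.sin (β * Real.pi) / 8 * Real.sin θ ^ β *
        (Q ^ 2 + 2 * P * Q * Real.cos (β * Real.pi) + P ^ 2)
      ≤ Real.sin (β * Real.pi) / 8 * (2 * (P * Q)) * 4 := by gcongr
    _ = P * Q * Real.sin (β * Real.pi) := by ring

theorem rpow_neg_sin_le {s θ : ℝ} (hs : 0 ≤ s) (hθ : θ ∈ Set.Ioo 0 Real.pi) :
    Real.sin θ ^ (-s) ≤ (2 / Real.pi * θ) ^ (-s) + (2 / Real.pi * (Real.pi - θ)) ^ (-s) := by
  have hpi := Real.pi_pos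
  have h1 : 0 < 2 / Real.pi * θ := mul_pos (by positivity) hθ.1
  have h2 : 0 < 2 / Real.pi * (Real.pi - θ) := mul_pos (by positivity) (by linarith [hθ.2])
  rcases le_total θ (Real.pi / 2) with h | h
  · have := Real.rpow_le_rpow_of_nonpos h1 (Real.mul_le_sin hθ.1.le h) (neg_nonpos.2 hs)
    linarith [Real.rpow_pos_of_pos h2 (-s)]
  · have h3 := Real.mul_le_sin (x := Real.pi - θ) (by linarith [hθ.2]) (by linarith)
    rw [Real.sin_pi_sub] at h3
    have := Real.rpow_le_rpow_of_nonpos h2 h3 (neg_nonpos.2 hs)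
    linarith [Real.rpow_pos_of_pos h1 (-s)]

theorem intervalIntegrable_rpow_add_rpow {s : ℝ} (hs : s < 1) :
    IntervalIntegrable (fun θ => (2 / Real.pi * θ) ^ (-s) + (2 / Real.pi * (Real.pi - θ)) ^ (-s))
      MeasureTheory.volume 0 Real.pi := by
  have h := intervalIntegral.intervalIntegrable_rpow' (a := 0) (b := 2) (r := -s) (by linarith)
  have hpi := Real.pi_pos
  have h1 := h.comp_mul_left (c := 2 / Real.pi)
  rw [zero_div, show 2 / (2 / Real.pi) = Real.pi by field_simp] at h1
  have h2 := (h1.comp_sub_left Real.pi).symm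
  rw [sub_zero, sub_self] at h2
  exact h1.add h2

theorem circleAverage_comp_lensMap {a b c β : ℝ} {f : ℂ → ℝ} (hab : a < b) (hβ : 0 < β)
    (hβ' : β < 1 / 2) (hβc : (b - a) * (Real.pi * β) < c) (hf : HarmonicOnNhd f (rectangle a b c))
    (hfc : ContinuousOn f (closure (rectangle a b c))) :
    Real.circleAverage (f ∘ lensMap a b β) 0 1 = f (lensMap a b β 0) ∧
      ContinuousOn (f ∘ lensMap a b β) (Metric.closedBall 0 1) := by
  have hmaps : Set.MapsTo (lensMap a b β) (Metric.ball 0 1) (rectangle a b c) := fun w hw => by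
    rw [mem_ball_zero_iff] at hw
    exact lensMap_mem_rectangle hab hβ hβ' hβc hw.le (Or.inl hw)
  have hcont := continuousOn_lensMap a b hβ hβ'
  have hmaps' : Set.MapsTo (lensMap a b β) (Metric.closedBall 0 1) (closure (rectangle a b c)) := by
    rw [← closure_ball (0 : ℂ) one_ne_zero] at hcont ⊢
    exact hmaps.closure_of_continuousOn hcont
  have hcomp := hfc.comp hcont hmaps'
  refine ⟨?_, hcomp⟩
  have hharm : HarmonicOnNhd (f ∘ lensMap a b β) (Metric.ball 0 1) := fun w hw =>
    harmonicAt_comp_analyticAt ((differentiableOn_lensMap a b hβ hβ').analyticAt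
      (Metric.isOpen_ball.mem_nhds hw)) (hf _ (hmaps hw))
  have hcl : HarmonicContOnCl (f ∘ lensMap a b β) (Metric.ball 0 |1|) := by
    rw [abs_one]
    exact HarmonicContOnCl.mk_ball hharm hcomp
  simpa using InnerProductSpace.HarmonicContOnCl.circleAverage_eq hcl

theorem integral_comp_lensMap_le {a b c β α M : ℝ} (hab : a < b) (hβ : 0 < β)
    (hβ' : β < 1 / 2) (hβc : (b - a) * (Real.pi * β) < c) (hα : 0 < α) (hαβ : β * α < 1)
    (hM : 0 < M) : ∃ K : ℝ, ∀ f : ℂ → ℝ, (∀ z ∈ rectangle a b c, f z ≤ M * z.im ^ (-α)) →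
      IntervalIntegrable (fun θ => f (lensMap a b β (circleMap 0 1 θ)))
        MeasureTheory.volume 0 Real.pi →
      ∫ θ in 0..Real.pi, f (lensMap a b β (circleMap 0 1 θ)) ≤ K := by
  have hpi := Real.pi_pos
  have hη : 0 < Real.sin (β * Real.pi) := Real.sin_pos_of_pos_of_lt_pi (by positivity) (by nlinarith)
  set k := (b - a) * Real.sin (β * Real.pi) / 8 with hk
  have hk0 : 0 < k := by
    have : 0 < b - a := by linarith
    positivity
  refine ⟨∫ θ in 0..Real.pi, M * k ^ (-α) * ((2 / Real.pi * θ) ^ (-(β * α)) +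
    (2 / Real.pi * (Real.pi - θ)) ^ (-(β * α))), fun f hf hint => ?_⟩
  refine intervalIntegral.integral_mono_on_of_le_Ioo hpi.le hint
    ((intervalIntegrable_rpow_add_rpow hαβ).const_mul _) fun θ hθ => ?_
  have hsin : 0 < Real.sin θ := Real.sin_pos_of_mem_Ioo hθ
  have hmem : lensMap a b β (circleMap 0 1 θ) ∈ rectangle a b c :=
    lensMap_mem_rectangle hab hβ hβ' hβc (norm_circleMap_one θ).le
      (Or.inr (by rwa [circleMap_im]))
  calc f (lensMap a b β (circleMap 0 1 θ))
      ≤ M * (lensMap a b β (circleMap 0 1 θ)).im ^ (-α) := hf _ hmem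
    _ ≤ M * (k * Real.sin θ ^ β) ^ (-α) := by
        refine mul_le_mul_of_nonneg_left ?_ hM.le
        exact Real.rpow_le_rpow_of_nonpos (mul_pos hk0 (Real.rpow_pos_of_pos hsin _))
          (le_im_lensMap_circleMap hab hβ hβ' hθ) (by linarith)
    _ = M * k ^ (-α) * Real.sin θ ^ (-(β * α)) := by
        rw [Real.mul_rpow hk0.le (Real.rpow_nonneg hsin.le _), ← Real.rpow_mul hsin.le,
          mul_neg, mul_assoc]
    _ ≤ _ := mul_le_mul_of_nonneg_left (rpow_neg_sin_le (by positivity) hθ)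
        (mul_nonneg hM.le (Real.rpow_nonneg hk0.le _))

theorem exists_integral_mul_le {a b δ M : ℝ} {κ : ℝ → ℝ} (hδ : 0 < δ) (hδ2 : δ < (b - a) / 2)
    (hκ : ContinuousOn κ (Set.Icc a b)) (hκ0 : ∀ x ∈ Set.Icc a b, 0 ≤ κ x)
    (hκpos : ∀ x ∈ Set.Ioo a b, 0 < κ x) :
    ∃ k > 0, ∃ K, ∀ g : ℝ → ℝ, ContinuousOn g (Set.Icc a b) →
      (∫ x in a..b, max (g x) 0) ≤ M →
      ∫ x in a..b, κ x * g x ≤ K + k * ∫ x in (a + δ)..(b - δ), min (g x) 0 := by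
  have hab : a < b := by linarith
  obtain ⟨x₀, hx₀, hmin⟩ := isCompact_Icc.exists_isMinOn (Set.nonempty_Icc.2
    (show a + δ ≤ b - δ by linarith)) (hκ.mono (Set.Icc_subset_Icc (by linarith) (by linarith)))
  obtain ⟨x₁, hx₁, hmax⟩ := isCompact_Icc.exists_isMaxOn (Set.nonempty_Icc.2 hab.le) hκ
  refine ⟨κ x₀, hκpos x₀ ⟨by linarith [hx₀.1], by linarith [hx₀.2]⟩, κ x₁ * M, fun g hg hgM => ?_⟩
  have hgp : ContinuousOn (fun x => max (g x) 0) (Set.Icc a b) := ContinuousOn.sup hg continuousOn_const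
  have hgm : ContinuousOn (fun x => min (g x) 0) (Set.Icc a b) := ContinuousOn.inf hg continuousOn_const
  have hu : Set.uIcc a b = Set.Icc a b := Set.uIcc_of_le hab.le
  have ii : ∀ {h : ℝ → ℝ}, ContinuousOn h (Set.Icc a b) →
      IntervalIntegrable h MeasureTheory.volume a b := fun h => by
    rw [← hu] at h; exact h.intervalIntegrable
  have hsub : Set.Icc (a + δ) (b - δ) ⊆ Set.Icc a b :=
    Set.Icc_subset_Icc (by linarith) (by linarith)
  have iip : IntervalIntegrable (fun x => κ x * max (g x) 0) MeasureTheory.volume a b :=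
    ii (hκ.mul hgp)
  have iim : IntervalIntegrable (fun x => κ x * min (g x) 0) MeasureTheory.volume a b :=
    ii (hκ.mul hgm)
  have hsplit : ∫ x in a..b, κ x * g x =
      (∫ x in a..b, κ x * max (g x) 0) + ∫ x in a..b, κ x * min (g x) 0 := by
    rw [← intervalIntegral.integral_add iip iim]
    refine intervalIntegral.integral_congr fun x _ => ?_
    simp only [← mul_add, max_add_min, add_zero]
  have hplus : ∫ x in a..b, κ x * max (g x) 0 ≤ κ x₁ * M := by
    calc ∫ x in a..b, κ x * max (g x) 0 ≤ ∫ x in a..b, κ x₁ * max (g x) 0 :=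
          intervalIntegral.integral_mono_on hab.le iip
            (ii (continuousOn_const.mul hgp)) fun x hx =>
            mul_le_mul_of_nonneg_right (hmax hx) (le_max_right _ _)
      _ = κ x₁ * ∫ x in a..b, max (g x) 0 := intervalIntegral.integral_const_mul _ _
      _ ≤ κ x₁ * M := mul_le_mul_of_nonneg_left hgM (hκ0 x₁ hx₁)
  have hminus : ∫ x in a..b, κ x * min (g x) 0 ≤
      κ x₀ * ∫ x in (a + δ)..(b - δ), min (g x) 0 := by
    have h1 : ∫ x in (a + δ)..(b - δ), κ x₀ * -min (g x) 0 ≤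
        ∫ x in (a + δ)..(b - δ), κ x * -min (g x) 0 := by
      have hu' : Set.uIcc (a + δ) (b - δ) = Set.Icc (a + δ) (b - δ) :=
        Set.uIcc_of_le (by linarith)
      refine intervalIntegral.integral_mono_on (by linarith) ?_ ?_ fun x hx =>
        mul_le_mul_of_nonneg_right (hmin hx) (neg_nonneg.2 (min_le_right _ _))
      · apply ContinuousOn.intervalIntegrable
        rw [hu']
        exact continuousOn_const.mul (hgm.mono hsub).neg
      · apply ContinuousOn.intervalIntegrable
        rw [hu']
        exact (hκ.mono hsub).mul (hgm.mono hsub).neg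
    have h2 : ∫ x in (a + δ)..(b - δ), κ x * -min (g x) 0 ≤
        ∫ x in a..b, κ x * -min (g x) 0 := by
      refine intervalIntegral.integral_mono_interval (by linarith) (by linarith) (by linarith) ?_
        (ii (hκ.mul hgm.neg))
      refine (MeasureTheory.ae_restrict_mem measurableSet_Ioc).mono fun x hx => ?_
      exact mul_nonneg (hκ0 x (Set.Ioc_subset_Icc_self hx)) (neg_nonneg.2 (min_le_right _ _))
    simp only [mul_neg, intervalIntegral.integral_neg, intervalIntegral.integral_const_mul]
      at h1 h2
    linarith
  linarith

theorem ofReal_mem_closure_rectangle {a b c x : ℝ} (hab : a < b) (hc : 0 < c)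
    (hx : x ∈ Set.Icc a b) : (x : ℂ) ∈ closure (rectangle a b c) := by
  have h : rectangle a b c = Set.Ioo a b ×ℂ Set.Ioo 0 c := by
    ext z
    simp [rectangle, mem_reProdIm, and_assoc]
  rw [h, closure_reProdIm, closure_Ioo hab.ne, closure_Ioo hc.ne, mem_reProdIm]
  exact ⟨by simpa using hx, by simpa using hc.le⟩

end

/-- a harmonic function on the rectangle `Π`, continuous on the
closure, with `∫_a^b f⁺ ≤ M`, `f(z) ≤ M (Im z)^{−α}` on `Π`, and `f(z₁) ≥ −M` at some
point `z₁ ∈ Π`, has `∫_{a+δ}^{b−δ} f⁻ ≥ −C` with `C = C(a, b, c, α, δ, M, z₁)`. -/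
theorem statement15 (a b c α δ M : ℝ) (z₁ : ℂ) (hab : a < b) (hc : 0 < c)
    (hα : 0 < α) (hM : 0 < M) (hz₁ : z₁ ∈ rectangle a b c)
    (hδ : 0 < δ) (hδ2 : δ < (b - a) / 2) :
    ∃ C > (0 : ℝ), ∀ f : ℂ → ℝ,
      IsHarmonicOn f (rectangle a b c) →
      ContinuousOn f (closure (rectangle a b c)) →
      (∫ x in a..b, max (f (x : ℂ)) 0) ≤ M →
      (∀ z ∈ rectangle a b c, f z ≤ M * z.im ^ (-α)) →
      -M ≤ f z₁ →
      -C ≤ ∫ x in (a + δ)..(b - δ), min (f (x : ℂ)) 0 := by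
  have hpi := Real.pi_pos
  have hL : 0 < b - a := by linarith
  obtain ⟨n, hn⟩ := exists_nat_gt (max 2 (max α ((b - a) * Real.pi / c)))
  obtain ⟨hn2, hn'⟩ := max_lt_iff.1 hn
  obtain ⟨hnα, hnc⟩ := max_lt_iff.1 hn'
  have hn0 : (0 : ℝ) < n := by linarith
  have hn0' : n ≠ 0 := by rintro rfl; simp at hn0
  have hβ : 0 < (n : ℝ)⁻¹ := by positivity
  have hβ' : (n : ℝ)⁻¹ < 1 / 2 := by
    rw [one_div]
    exact inv_strictAnti₀ two_pos hn2
  have hβc : (b - a) * (Real.pi * (n : ℝ)⁻¹) < c := by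
    rw [div_lt_iff₀ hc] at hnc
    rw [← mul_assoc, ← div_eq_mul_inv, div_lt_iff₀ hn0]
    linarith
  have hαβ : (n : ℝ)⁻¹ * α < 1 := by
    rw [inv_mul_lt_iff₀ hn0]
    linarith
  set z₂ := lensMap a b (n : ℝ)⁻¹ 0 with hz₂
  have hz₂mem : z₂ ∈ rectangle a b c :=
    lensMap_mem_rectangle hab hβ hβ' hβc (by simp) (by simp)
  have hKcont : ContinuousOn (fun z : ℂ => M * z.im ^ (-α)) (rectangle a b c) :=
    continuousOn_const.mul (Complex.continuous_im.continuousOn.rpow_const fun z hz => Or.inl hz.2.2.1.ne')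
  obtain ⟨C₀, hC₀⟩ := exists_forall_le_of_segment (isOpen_rectangle a b c) hKcont
    ((convex_rectangle a b c).segment_subset hz₁ hz₂mem) M
  obtain ⟨K₁, hK₁⟩ := integral_comp_lensMap_le hab hβ hβ' hβc hα hαβ hM
  obtain ⟨k, hk, K₂, hK₂⟩ := exists_integral_mul_le (M := M) hδ hδ2
    (continuousOn_lensDensity hab n) (fun x => lensDensity_nonneg n)
    (fun x => lensDensity_pos hn0')
  refine ⟨max 1 ((2 * Real.pi * C₀ + K₁ + K₂) / k), lt_max_of_lt_left one_pos,
    fun f hf hfc hfM hfα hf1 => ?_⟩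
  have hharm := hf.harmonicOnNhd (isOpen_rectangle a b c)
  obtain ⟨havg, hcont⟩ := circleAverage_comp_lensMap hab hβ hβ' hβc hharm hfc
  have hφ : Continuous fun θ => f (lensMap a b (n : ℝ)⁻¹ (circleMap 0 1 θ)) :=
    hcont.comp_continuous (continuous_circleMap 0 1) fun θ => by
      simp
  have h1 := hC₀ f hharm hfα hf1
  have h2 := hK₁ f hfα (hφ.intervalIntegrable _ _)
  have h3 := hK₂ (fun x => f x) (hfc.comp Complex.continuous_ofReal.continuousOn
    fun x hx => ofReal_mem_closure_rectangle hab hc hx) hfM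
  rw [← integral_comp_lensMap_circleMap hab hn0' f] at h3
  have h4 := intervalIntegral.integral_add_adjacent_intervals
    (hφ.intervalIntegrable (μ := MeasureTheory.volume) 0 Real.pi)
    (hφ.intervalIntegrable Real.pi (2 * Real.pi))
  rw [Real.circleAverage_def, smul_eq_mul, inv_mul_eq_iff_eq_mul₀ (by positivity)] at havg
  simp only [Function.comp_apply] at havg
  rw [havg, ← hz₂] at h4
  have h5 : 2 * Real.pi * -C₀ ≤ 2 * Real.pi * f z₂ := mul_le_mul_of_nonneg_left h1 (by positivity)
  refine (neg_le_neg (le_max_right _ _)).trans ?_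
  rw [← neg_div, div_le_iff₀ hk]
  linarith
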